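/- arXiv:2507.15284 — 2 statements merged into one kernel-verified Lean document; each statement's English description precedes it below -/
import Mathlib

section
/- Let U ⊆ ℍ° be open and let u, v : U → ℝ be smooth. Define Φ : U → M₂(ℝ) by Φ := [[ρe^u + ρ⁻¹e^{−u}v², ρ⁻¹e^{−u}v],[ρ⁻¹e^{−u}v, ρ⁻¹e^{−u}]]. Then Φ is symmetric positive definite with det Φ ≡ 1, and Φ satisfies the axisymmetric harmonic-map equation on U if and only if the pair (u,v) satisfies the system u_{ρρ} + ρ⁻¹u_ρ + u_{zz} = −ρ⁻²e^{−2u}(v_ρ² + v_z²) and ∂_ρ(ρ⁻¹e^{−2u}v_ρ) + ∂_z(ρ⁻¹e^{−2u}v_z) = 0 on U. -/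
noncomputable section

open Real Topology Filter Matrix MeasureTheory

abbrev Mat2 : Type := Matrix (Fin 2) (Fin 2) ℝ

/-- Partial derivative in the first variable (`ρ`). -/
def pd1 (f : ℝ × ℝ → ℝ) (p : ℝ × ℝ) : ℝ := deriv (fun t => f (t, p.2)) p.1

/-- Partial derivative in the second variable (`z`). -/
def pd2 (f : ℝ × ℝ → ℝ) (p : ℝ × ℝ) : ℝ := deriv (fun t => f (p.1, t)) p.2

/-- Entrywise partial derivative (in `ρ`) of a matrix-valued function. -/
def mpd1 (F : ℝ × ℝ → Mat2) (p : ℝ × ℝ) : Mat2 :=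
  Matrix.of fun i j => pd1 (fun q => F q i j) p

/-- Entrywise partial derivative (in `z`) of a matrix-valued function. -/
def mpd2 (F : ℝ × ℝ → Mat2) (p : ℝ × ℝ) : Mat2 :=
  Matrix.of fun i j => pd2 (fun q => F q i j) p

/-- The open right half plane `ℍ° = {(ρ, z) : ρ > 0}`. -/
def Hplane : Set (ℝ × ℝ) := {p | 0 < p.1}

/-- A matrix-valued map is smooth on a set if each entry is `C^∞` there. -/
def SmoothMatOn (F : ℝ × ℝ → Mat2) (U : Set (ℝ × ℝ)) : Prop :=
  ∀ i j, ContDiffOn ℝ (⊤ : ℕ∞) (fun q => F q i j) U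

/-- The axisymmetric harmonic-map equation
`∂_ρ(ρ Φ⁻¹ ∂_ρΦ) + ∂_z(ρ Φ⁻¹ ∂_zΦ) = 0` on `U`. -/
def axiHarmonicOn (Φ : ℝ × ℝ → Mat2) (U : Set (ℝ × ℝ)) : Prop :=
  ∀ p ∈ U,
    mpd1 (fun q => q.1 • ((Φ q)⁻¹ * mpd1 Φ q)) p +
      mpd2 (fun q => q.1 • ((Φ q)⁻¹ * mpd2 Φ q)) p = 0

/-- `𝒰 := I + ρ Φ⁻¹ ∂_ρΦ`. -/
def Umat (Φ : ℝ × ℝ → Mat2) (p : ℝ × ℝ) : Mat2 := 1 + p.1 • ((Φ p)⁻¹ * mpd1 Φ p)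

/-- `𝒱 := ρ Φ⁻¹ ∂_zΦ`. -/
def Vmat (Φ : ℝ × ℝ → Mat2) (p : ℝ × ℝ) : Mat2 := p.1 • ((Φ p)⁻¹ * mpd2 Φ p)

/-- `ν` is an augmentation for `Φ` on `U`. -/
def IsAugmentationOn (Φ : ℝ × ℝ → Mat2) (ν : ℝ × ℝ → ℝ) (U : Set (ℝ × ℝ)) : Prop :=
  ContDiffOn ℝ (⊤ : ℕ∞) ν U ∧ ∀ p ∈ U,
    pd2 ν p = (4 * p.1)⁻¹ * (Umat Φ p * Vmat Φ p).trace ∧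
    pd1 ν p = -(2 * p.1)⁻¹ +
      (8 * p.1)⁻¹ * (Umat Φ p * Umat Φ p - Vmat Φ p * Vmat Φ p).trace

/-- `r = √(ρ² + z²)`. -/
def rr (p : ℝ × ℝ) : ℝ := Real.sqrt (p.1 ^ 2 + p.2 ^ 2)

/-- The action `P.Φ := (P⁻¹)ᵀ Φ P⁻¹` of `GL(2,ℝ)` on matrices. -/
def matAct (P M : Mat2) : Mat2 := (P⁻¹)ᵀ * M * P⁻¹

/-- The action of `GL(2,ℝ)` on matrix-valued maps. -/
def mapAct (P : Mat2) (Φ : ℝ × ℝ → Mat2) : ℝ × ℝ → Mat2 := fun q => matAct P (Φ q)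

/-- The rod-interior matrix as a function of the values `r = ρ`, `a = u`, `b = v`. -/
def rodMat (r a b : ℝ) : Mat2 :=
  !![r * Real.exp a + Real.exp (-a) * b ^ 2 / r, Real.exp (-a) * b / r;
     Real.exp (-a) * b / r, Real.exp (-a) / r]

/-- The directional current `ρ Φ⁻¹ ∂Φ` in terms of `s = ∂ρ + ρ ∂u` and `w = ρ⁻¹ e^{-2u} ∂v`. -/
def rodCurrent (r a b s w : ℝ) : Mat2 :=
  !![s + b * w, w;
     r ^ 2 * Real.exp (2 * a) * w - 2 * b * s - b ^ 2 * w, -(s + b * w)]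

lemma rodMat_det {r : ℝ} (hr : 0 < r) (a b : ℝ) : (rodMat r a b).det = 1 := by
  rw [rodMat, Matrix.det_fin_two_of, Real.exp_neg]
  have := Real.exp_ne_zero a
  field_simp
  ring

lemma rodMat_posDef {r : ℝ} (hr : 0 < r) (a b : ℝ) : (rodMat r a b).PosDef := by
  refine Matrix.PosDef.of_dotProduct_mulVec_pos ?_ fun x hx => ?_
  · ext i j
    fin_cases i <;> fin_cases j <;> simp [rodMat]
  · have key : star x ⬝ᵥ (rodMat r a b *ᵥ x) =
        r * Real.exp a * x 0 ^ 2 + Real.exp (-a) / r * (b * x 0 + x 1) ^ 2 := by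
      simp [rodMat, Matrix.mulVec, dotProduct, Fin.sum_univ_two]
      field_simp
      ring
    rw [key]
    by_cases h0 : x 0 = 0
    · have h1 : x 1 ≠ 0 := fun h1 => hx (by ext i; fin_cases i <;> simp [h0, h1])
      rw [h0, mul_zero, zero_add]
      positivity
    · positivity

lemma rodMat_inv {r : ℝ} (hr : 0 < r) (a b : ℝ) :
    (rodMat r a b)⁻¹ =
      !![Real.exp (-a) / r, -(Real.exp (-a) * b / r);
         -(Real.exp (-a) * b / r), r * Real.exp a + Real.exp (-a) * b ^ 2 / r] := by
  rw [Matrix.inv_def, rodMat_det hr, rodMat, Matrix.adjugate_fin_two_of]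
  simp

lemma of_fin_two_eq {f : Fin 2 → Fin 2 → ℝ} {a b c d : ℝ} (h00 : f 0 0 = a) (h01 : f 0 1 = b)
    (h10 : f 1 0 = c) (h11 : f 1 1 = d) : Matrix.of f = !![a, b; c, d] := by
  ext i j
  fin_cases i <;> fin_cases j <;> assumption

lemma rodCurrent_eq {r a b : ℝ → ℝ} {r' a' b' t : ℝ} (hr : HasDerivAt r r' t)
    (ha : HasDerivAt a a' t) (hb : HasDerivAt b b' t) (hpos : 0 < r t) :
    r t • ((rodMat (r t) (a t) (b t))⁻¹ *
        Matrix.of fun i j => deriv (fun x => rodMat (r x) (a x) (b x) i j) t) =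
      rodCurrent (r t) (a t) (b t) (r' + r t * a')
        ((r t)⁻¹ * Real.exp (-(2 * a t)) * b') := by
  have hne := hpos.ne'
  have hE := ha.exp
  have hN := ha.neg.exp
  have h00 := ((hr.mul hE).add ((hN.mul (hb.pow 2)).div hr hne)).deriv
  have h01 := ((hN.mul hb).div hr hne).deriv
  have h11 := (hN.div hr hne).deriv
  have hexp : Real.exp (-(2 * a t)) = (Real.exp (a t))⁻¹ ^ 2 := by
    rw [← Real.exp_neg, ← Real.exp_nat_mul]; congr 1; push_cast; ring
  have hexp2 : Real.exp (2 * a t) = Real.exp (a t) ^ 2 := by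
    rw [← Real.exp_nat_mul]; congr 1
  have hD := of_fin_two_eq (f := fun i j => deriv (fun x => rodMat (r x) (a x) (b x) i j) t)
    h00 h01 h01 h11
  rw [hD, rodMat_inv hpos, rodCurrent, hexp, hexp2]
  have := Real.exp_ne_zero (a t)
  ext i j
  fin_cases i <;> fin_cases j <;>
  · simp [Real.exp_neg]
    field_simp
    ring

lemma deriv_rodCurrent {r a b s w : ℝ → ℝ} {r' a' b' s' w' t : ℝ} (hr : HasDerivAt r r' t)
    (ha : HasDerivAt a a' t) (hb : HasDerivAt b b' t) (hs : HasDerivAt s s' t)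
    (hw : HasDerivAt w w' t) (hpos : 0 < r t) (hst : s t = r' + r t * a')
    (hwt : w t = (r t)⁻¹ * Real.exp (-(2 * a t)) * b') :
    (Matrix.of fun i j => deriv (fun x => rodCurrent (r x) (a x) (b x) (s x) (w x) i j) t) =
      !![s' + b' * w t + b t * w', w';
         (r t) ^ 2 * Real.exp (2 * a t) * w' - 2 * b t * (s' + b' * w t) - b t ^ 2 * w',
         -(s' + b' * w t + b t * w')] := by
  have h00 := hs.add (hb.mul hw)
  have h10 := ((((hr.pow 2).mul (ha.const_mul 2).exp).mul hw).sub
    ((hb.const_mul 2).mul hs)).sub ((hb.pow 2).mul hw)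
  ext i j
  fin_cases i <;> fin_cases j
  · refine h00.deriv.trans ?_
    simp; ring
  · exact hw.deriv
  · refine h10.deriv.trans ?_
    have := hpos.ne'
    have := Real.exp_ne_zero (2 * a t)
    simp [hst, hwt, Real.exp_neg]
    field_simp
    ring
  · refine h00.neg.deriv.trans ?_
    simp; ring

section PartialDerivatives

variable {U : Set (ℝ × ℝ)} {f g : ℝ × ℝ → ℝ} {p : ℝ × ℝ}

lemma pd1_congr (hU : IsOpen U) (h : ∀ q ∈ U, f q = g q) (hp : p ∈ U) : pd1 f p = pd1 g p := by
  refine Filter.EventuallyEq.deriv_eq ?_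
  have : ContinuousAt (fun t : ℝ => (t, p.2)) p.1 := by fun_prop
  filter_upwards [this.eventually (hU.mem_nhds hp)] with t ht using h _ ht

lemma pd2_congr (hU : IsOpen U) (h : ∀ q ∈ U, f q = g q) (hp : p ∈ U) : pd2 f p = pd2 g p := by
  refine Filter.EventuallyEq.deriv_eq ?_
  have : ContinuousAt (fun t : ℝ => (p.1, t)) p.2 := by fun_prop
  filter_upwards [this.eventually (hU.mem_nhds hp)] with t ht using h _ ht

lemma hasDerivAt_fst_fderiv (hf : DifferentiableAt ℝ f p) :
    HasDerivAt (fun t => f (t, p.2)) (fderiv ℝ f p (1, 0)) p.1 :=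
  HasFDerivAt.comp_hasDerivAt (f := fun t => (t, p.2)) p.1 hf.hasFDerivAt
    ((hasDerivAt_id p.1).prodMk (hasDerivAt_const p.1 p.2))

lemma hasDerivAt_snd_fderiv (hf : DifferentiableAt ℝ f p) :
    HasDerivAt (fun t => f (p.1, t)) (fderiv ℝ f p (0, 1)) p.2 :=
  HasFDerivAt.comp_hasDerivAt (f := fun t => (p.1, t)) p.2 hf.hasFDerivAt
    ((hasDerivAt_const p.2 p.1).prodMk (hasDerivAt_id p.2))

lemma hasDerivAt_pd1 (hf : DifferentiableAt ℝ f p) :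
    HasDerivAt (fun t => f (t, p.2)) (pd1 f p) p.1 :=
  (hasDerivAt_fst_fderiv hf).differentiableAt.hasDerivAt

lemma hasDerivAt_pd2 (hf : DifferentiableAt ℝ f p) :
    HasDerivAt (fun t => f (p.1, t)) (pd2 f p) p.2 :=
  (hasDerivAt_snd_fderiv hf).differentiableAt.hasDerivAt

lemma differentiableAt_of_smooth (hU : IsOpen U) (hf : ContDiffOn ℝ (⊤ : ℕ∞) f U) (hp : p ∈ U) :
    DifferentiableAt ℝ f p :=
  (hf.contDiffAt (hU.mem_nhds hp)).differentiableAt (by simp)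

lemma contDiffOn_pd1 (hU : IsOpen U) (hf : ContDiffOn ℝ (⊤ : ℕ∞) f U) :
    ContDiffOn ℝ (⊤ : ℕ∞) (pd1 f) U :=
  ((hf.fderiv_of_isOpen hU le_rfl).clm_apply contDiffOn_const).congr fun _ hp =>
    (hasDerivAt_fst_fderiv (differentiableAt_of_smooth hU hf hp)).deriv

lemma contDiffOn_pd2 (hU : IsOpen U) (hf : ContDiffOn ℝ (⊤ : ℕ∞) f U) :
    ContDiffOn ℝ (⊤ : ℕ∞) (pd2 f) U :=
  ((hf.fderiv_of_isOpen hU le_rfl).clm_apply contDiffOn_const).congr fun _ hp =>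
    (hasDerivAt_snd_fderiv (differentiableAt_of_smooth hU hf hp)).deriv

end PartialDerivatives

section Divergence

variable {U : Set (ℝ × ℝ)} {u v : ℝ × ℝ → ℝ} {p : ℝ × ℝ}

lemma mpd1_rodCurrent (hU : IsOpen U) (hUH : U ⊆ Hplane) (hu : ContDiffOn ℝ (⊤ : ℕ∞) u U)
    (hv : ContDiffOn ℝ (⊤ : ℕ∞) v U) (hp : p ∈ U) :
    let w := fun q : ℝ × ℝ => q.1⁻¹ * Real.exp (-(2 * u q)) * pd1 v q
    let s' := pd1 u p + p.1 * pd1 (pd1 u) p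
    mpd1 (fun q => q.1 • ((rodMat q.1 (u q) (v q))⁻¹ *
        mpd1 (fun q => rodMat q.1 (u q) (v q)) q)) p =
      !![s' + pd1 v p * w p + v p * pd1 w p, pd1 w p;
         p.1 ^ 2 * Real.exp (2 * u p) * pd1 w p - 2 * v p * (s' + pd1 v p * w p)
           - v p ^ 2 * pd1 w p,
         -(s' + pd1 v p * w p + v p * pd1 w p)] := by
  intro w s'
  have diff {f : ℝ × ℝ → ℝ} (hf : ContDiffOn ℝ (⊤ : ℕ∞) f U) {q : ℝ × ℝ} (hq : q ∈ U) :=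
    hasDerivAt_pd1 (differentiableAt_of_smooth hU hf hq)
  have hpos : 0 < p.1 := hUH hp
  have hcur : ∀ q ∈ U, q.1 • ((rodMat q.1 (u q) (v q))⁻¹ *
      mpd1 (fun q => rodMat q.1 (u q) (v q)) q) =
      rodCurrent q.1 (u q) (v q) (1 + q.1 * pd1 u q) (w q) := fun q hq =>
    rodCurrent_eq (r := fun t => t) (a := fun t => u (t, q.2)) (b := fun t => v (t, q.2))
      (hasDerivAt_id q.1) (diff hu hq) (diff hv hq) (hUH hq)
  have hw : DifferentiableAt ℝ w p := by
    have h1 := differentiableAt_of_smooth hU hu hp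
    have h2 := differentiableAt_of_smooth hU (contDiffOn_pd1 hU hv) hp
    have h3 : DifferentiableAt ℝ (fun q : ℝ × ℝ => q.1⁻¹) p := differentiableAt_fst.inv hpos.ne'
    exact (h3.mul (h1.const_mul 2).neg.exp).mul h2
  have hs : HasDerivAt (fun t => 1 + t * pd1 u (t, p.2)) s' p.1 := by
    simpa [s'] using
      ((hasDerivAt_id p.1).mul (diff (contDiffOn_pd1 hU hu) hp)).const_add 1
  have key := deriv_rodCurrent (r := fun t => t) (a := fun t => u (t, p.2))
    (b := fun t => v (t, p.2))
    (s := fun t => 1 + t * pd1 u (t, p.2)) (w := fun t => w (t, p.2))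
    (hasDerivAt_id p.1) (diff hu hp) (diff hv hp) hs (hasDerivAt_pd1 hw) hpos rfl rfl
  refine Eq.trans ?_ key
  ext i j
  exact pd1_congr (g := fun q => rodCurrent q.1 (u q) (v q) (1 + q.1 * pd1 u q) (w q) i j) hU
    (fun q hq => congrFun (congrFun (hcur q hq) i) j) hp

lemma mpd2_rodCurrent (hU : IsOpen U) (hUH : U ⊆ Hplane) (hu : ContDiffOn ℝ (⊤ : ℕ∞) u U)
    (hv : ContDiffOn ℝ (⊤ : ℕ∞) v U) (hp : p ∈ U) :
    let w := fun q : ℝ × ℝ => q.1⁻¹ * Real.exp (-(2 * u q)) * pd2 v q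
    let s' := p.1 * pd2 (pd2 u) p
    mpd2 (fun q => q.1 • ((rodMat q.1 (u q) (v q))⁻¹ *
        mpd2 (fun q => rodMat q.1 (u q) (v q)) q)) p =
      !![s' + pd2 v p * w p + v p * pd2 w p, pd2 w p;
         p.1 ^ 2 * Real.exp (2 * u p) * pd2 w p - 2 * v p * (s' + pd2 v p * w p)
           - v p ^ 2 * pd2 w p,
         -(s' + pd2 v p * w p + v p * pd2 w p)] := by
  intro w s'
  have diff {f : ℝ × ℝ → ℝ} (hf : ContDiffOn ℝ (⊤ : ℕ∞) f U) {q : ℝ × ℝ} (hq : q ∈ U) :=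
    hasDerivAt_pd2 (differentiableAt_of_smooth hU hf hq)
  have hpos : 0 < p.1 := hUH hp
  have hcur : ∀ q ∈ U, q.1 • ((rodMat q.1 (u q) (v q))⁻¹ *
      mpd2 (fun q => rodMat q.1 (u q) (v q)) q) =
      rodCurrent q.1 (u q) (v q) (0 + q.1 * pd2 u q) (w q) := fun q hq =>
    rodCurrent_eq (r := fun _ => q.1) (a := fun t => u (q.1, t)) (b := fun t => v (q.1, t))
      (hasDerivAt_const q.2 q.1) (diff hu hq) (diff hv hq) (hUH hq)
  have hw : DifferentiableAt ℝ w p := by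
    have h1 := differentiableAt_of_smooth hU hu hp
    have h2 := differentiableAt_of_smooth hU (contDiffOn_pd2 hU hv) hp
    have h3 : DifferentiableAt ℝ (fun q : ℝ × ℝ => q.1⁻¹) p := differentiableAt_fst.inv hpos.ne'
    exact (h3.mul (h1.const_mul 2).neg.exp).mul h2
  have hs : HasDerivAt (fun t => 0 + p.1 * pd2 u (p.1, t)) s' p.2 :=
    ((diff (contDiffOn_pd2 hU hu) hp).const_mul p.1).const_add 0
  have key := deriv_rodCurrent (r := fun _ => p.1) (a := fun t => u (p.1, t)) (b := fun t => v (p.1, t))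
    (s := fun t => 0 + p.1 * pd2 u (p.1, t)) (w := fun t => w (p.1, t))
    (hasDerivAt_const p.2 p.1) (diff hu hp) (diff hv hp) hs (hasDerivAt_pd2 hw) hpos rfl rfl
  refine Eq.trans ?_ key
  ext i j
  exact pd2_congr (g := fun q => rodCurrent q.1 (u q) (v q) (0 + q.1 * pd2 u q) (w q) i j) hU
    (fun q hq => congrFun (congrFun (hcur q hq) i) j) hp

end Divergence

/-- The rod-interior parametrization
`Φ = [[ρe^u + ρ⁻¹e^{−u}v², ρ⁻¹e^{−u}v],[ρ⁻¹e^{−u}v, ρ⁻¹e^{−u}]]` is symmetric positive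
definite with determinant `1`, and it satisfies the axisymmetric harmonic-map equation
iff `(u,v)` satisfies the reduced system. -/
theorem stmt3 (U : Set (ℝ × ℝ)) (hUopen : IsOpen U) (hUH : U ⊆ Hplane)
    (u v : ℝ × ℝ → ℝ)
    (hu : ContDiffOn ℝ (⊤ : ℕ∞) u U) (hv : ContDiffOn ℝ (⊤ : ℕ∞) v U) :
    (∀ p ∈ U,
      (!![p.1 * Real.exp (u p) + Real.exp (-(u p)) * (v p) ^ 2 / p.1,
            Real.exp (-(u p)) * v p / p.1;
          Real.exp (-(u p)) * v p / p.1, Real.exp (-(u p)) / p.1] : Mat2).PosDef ∧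
      (!![p.1 * Real.exp (u p) + Real.exp (-(u p)) * (v p) ^ 2 / p.1,
            Real.exp (-(u p)) * v p / p.1;
          Real.exp (-(u p)) * v p / p.1, Real.exp (-(u p)) / p.1] : Mat2).det = 1) ∧
    (axiHarmonicOn (fun p =>
        !![p.1 * Real.exp (u p) + Real.exp (-(u p)) * (v p) ^ 2 / p.1,
              Real.exp (-(u p)) * v p / p.1;
            Real.exp (-(u p)) * v p / p.1, Real.exp (-(u p)) / p.1]) U ↔
      (∀ p ∈ U,
        pd1 (pd1 u) p + p.1⁻¹ * pd1 u p + pd2 (pd2 u) p =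
          -((p.1 ^ 2)⁻¹ * Real.exp (-(2 * u p)) * ((pd1 v p) ^ 2 + (pd2 v p) ^ 2)) ∧
        pd1 (fun q => q.1⁻¹ * Real.exp (-(2 * u q)) * pd1 v q) p +
          pd2 (fun q => q.1⁻¹ * Real.exp (-(2 * u q)) * pd2 v q) p = 0)) := by
  refine ⟨fun p hp => ⟨rodMat_posDef (hUH hp) _ _, rodMat_det (hUH hp) _ _⟩,
    forall₂_congr fun p hp => ?_⟩
  have hpos : 0 < p.1 := hUH hp
  have hne := hpos.ne'
  have h1 := mpd1_rodCurrent hUopen hUH hu hv hp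
  have h2 := mpd2_rodCurrent hUopen hUH hu hv hp
  simp only [rodMat] at h1 h2
  rw [h1, h2]
  set w₁ := pd1 (fun q => q.1⁻¹ * Real.exp (-(2 * u q)) * pd1 v q) p
  set w₂ := pd2 (fun q => q.1⁻¹ * Real.exp (-(2 * u q)) * pd2 v q) p
  set L := pd1 (pd1 u) p + p.1⁻¹ * pd1 u p + pd2 (pd2 u) p
  set N := (p.1 ^ 2)⁻¹ * Real.exp (-(2 * u p)) * ((pd1 v p) ^ 2 + (pd2 v p) ^ 2)
  have hLN : p.1 * (L + N) =
      (pd1 u p + p.1 * pd1 (pd1 u) p + pd1 v p * (p.1⁻¹ * Real.exp (-(2 * u p)) * pd1 v p)) +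
        (p.1 * pd2 (pd2 u) p + pd2 v p * (p.1⁻¹ * Real.exp (-(2 * u p)) * pd2 v p)) := by
    simp only [L, N]
    field_simp
    ring
  constructor
  · intro h
    have h00 := congrFun (congrFun h 0) 0
    have h01 := congrFun (congrFun h 0) 1
    simp at h00 h01
    have hprod : p.1 * (L + N) = 0 := by
      linear_combination hLN + h00 - v p * h01
    exact ⟨eq_neg_of_add_eq_zero_left ((mul_eq_zero.mp hprod).resolve_left hne), h01⟩
  · rintro ⟨hL, hw⟩
    rw [hL, neg_add_cancel, mul_zero] at hLN
    ext i j
    fin_cases i <;> fin_cases j <;> simp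
    · linear_combination v p * hw - hLN
    · exact hw
    · linear_combination
        (p.1 ^ 2 * Real.exp (2 * u p) - v p ^ 2) * hw + 2 * v p * hLN
    · linear_combination hLN - v p * hw
end
end

section
/- For every α ≥ 0, the model map Φ^{TN⁻_α} := ρ⁻¹[[H_α⁻¹A_α² + ρ²H_α, H_α⁻¹A_α],[H_α⁻¹A_α, H_α⁻¹]] (with H_α := 1 + α/(2r), A_α := αz/(2r), r := √(ρ²+z²)) is symmetric positive definite with det Φ^{TN⁻_α} ≡ 1 on ℍ°, it satisfies the axisymmetric harmonic-map equation on ℍ°, and ν^{TN⁻_α} := ½·log(1 + α/(2r)) is an augmentation for it. In particular, for α = 0 one gets the flat model Φ^{AF₀} = diag(ρ, ρ⁻¹) with augmentation 0. -/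
noncomputable section

open Real Topology Filter Matrix MeasureTheory

/-- `H_α = 1 + α/(2r)`. -/
def Hfun (α : ℝ) (p : ℝ × ℝ) : ℝ := 1 + α / (2 * rr p)

/-- `A_α = αz/(2r)`. -/
def Afun (α : ℝ) (p : ℝ × ℝ) : ℝ := α * p.2 / (2 * rr p)

/-- The anti–Taub-NUT model family `Φ^{TN⁻_α}`. -/
def ΦTNm (α : ℝ) (p : ℝ × ℝ) : Mat2 :=
  p.1⁻¹ • !![(Hfun α p)⁻¹ * (Afun α p) ^ 2 + p.1 ^ 2 * Hfun α p, (Hfun α p)⁻¹ * Afun α p;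
             (Hfun α p)⁻¹ * Afun α p, (Hfun α p)⁻¹]

/-- The augmentation `ν^{TN⁻_α} = ½ log(1 + α/(2r))`. -/
def νTNm (α : ℝ) (p : ℝ × ℝ) : ℝ := (1 / 2) * Real.log (1 + α / (2 * rr p))

/-- The matrix `ρ⁻¹ [[h⁻¹A² + ρ²h, h⁻¹A], [h⁻¹A, h⁻¹]]`. -/
def gibbonsHawkingMat (ρ h A : ℝ) : Mat2 :=
  ρ⁻¹ • !![h⁻¹ * A ^ 2 + ρ ^ 2 * h, h⁻¹ * A; h⁻¹ * A, h⁻¹]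

/-- The general shape of `ρ Φ⁻¹ ∂Φ` for `Φ = gibbonsHawkingMat ρ h A`, where
`q = ρ ∂(log (ρ h))`, `w = ∂A / (ρ h²)` and `g = ρ ∂A`. -/
def gibbonsHawkingForm (q w g A : ℝ) : Mat2 :=
  !![q + A * w, w; g - 2 * A * q - A ^ 2 * w, -(q + A * w)]

lemma gibbonsHawkingMat_det {ρ h : ℝ} (A : ℝ) (hρ : ρ ≠ 0) (hh : h ≠ 0) :
    (gibbonsHawkingMat ρ h A).det = 1 := by
  simp [gibbonsHawkingMat, Matrix.det_fin_two]
  field_simp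
  ring

lemma gibbonsHawkingMat_posDef {ρ h : ℝ} (A : ℝ) (hρ : 0 < ρ) (hh : 0 < h) :
    (gibbonsHawkingMat ρ h A).PosDef := by
  refine Matrix.PosDef.of_dotProduct_mulVec_pos ?_ fun x hx => ?_
  · ext i j
    fin_cases i <;> fin_cases j <;> simp [gibbonsHawkingMat]
  · have key : star x ⬝ᵥ (gibbonsHawkingMat ρ h A *ᵥ x) =
        ρ * h * x 0 ^ 2 + (ρ * h)⁻¹ * (A * x 0 + x 1) ^ 2 := by
      simp [gibbonsHawkingMat, Matrix.mulVec, dotProduct, Fin.sum_univ_two]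
      field_simp
      ring
    rw [key]
    by_cases h0 : x 0 = 0
    · have h1 : x 1 ≠ 0 := fun h1 => hx (by ext i; fin_cases i <;> simp [h0, h1])
      rw [h0]
      have := pow_pos (abs_pos.2 h1) 2
      rw [sq_abs] at this
      simp only [mul_zero, zero_add]
      positivity
    · have : 0 < x 0 ^ 2 := by positivity
      positivity

lemma gibbonsHawkingMat_inv {ρ h : ℝ} (A : ℝ) (hρ : ρ ≠ 0) (hh : h ≠ 0) :
    (gibbonsHawkingMat ρ h A)⁻¹ =
      ρ⁻¹ • !![h⁻¹, -(h⁻¹ * A); -(h⁻¹ * A), h⁻¹ * A ^ 2 + ρ ^ 2 * h] := by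
  rw [Matrix.inv_def, gibbonsHawkingMat_det A hρ hh, Matrix.adjugate_fin_two]
  ext i j
  fin_cases i <;> fin_cases j <;> simp [gibbonsHawkingMat]

lemma smul_inv_mul_deriv_gibbonsHawkingMat {ρ h A : ℝ → ℝ} {ρ' h' A' t : ℝ}
    (dρ : HasDerivAt ρ ρ' t) (dh : HasDerivAt h h' t) (dA : HasDerivAt A A' t)
    (hρ : ρ t ≠ 0) (hh : h t ≠ 0) :
    ρ t • ((gibbonsHawkingMat (ρ t) (h t) (A t))⁻¹ *
      Matrix.of fun i j => deriv (fun s => gibbonsHawkingMat (ρ s) (h s) (A s) i j) t) =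
      gibbonsHawkingForm (ρ' + ρ t * h' / h t) (A' / (ρ t * h t ^ 2)) (ρ t * A') (A t) := by
  have d00 := (dρ.inv hρ).mul (((dh.inv hh).mul (dA.pow 2)).add ((dρ.pow 2).mul dh))
  have d01 := (dρ.inv hρ).mul ((dh.inv hh).mul dA)
  have d11 := (dρ.inv hρ).mul (dh.inv hh)
  have e00 : deriv (fun s => gibbonsHawkingMat (ρ s) (h s) (A s) 0 0) t = _ := d00.deriv
  have e01 : deriv (fun s => gibbonsHawkingMat (ρ s) (h s) (A s) 0 1) t = _ := d01.deriv
  have e10 : deriv (fun s => gibbonsHawkingMat (ρ s) (h s) (A s) 1 0) t = _ := d01.deriv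
  have e11 : deriv (fun s => gibbonsHawkingMat (ρ s) (h s) (A s) 1 1) t = _ := d11.deriv
  rw [gibbonsHawkingMat_inv _ hρ hh,
    Matrix.eta_fin_two
      (Matrix.of fun i j => deriv (fun s => gibbonsHawkingMat (ρ s) (h s) (A s) i j) t)]
  simp only [Matrix.of_apply (fun i j => deriv (fun s => gibbonsHawkingMat (ρ s) (h s) (A s) i j) t),
    e00, e01, e10, e11]
  ext i j
  fin_cases i <;> fin_cases j <;>
    simp [gibbonsHawkingForm] <;> field_simp <;> ring

lemma rr_pos {p : ℝ × ℝ} (hp : p ∈ Hplane) : 0 < rr p := by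
  have : 0 < p.1 := hp
  exact Real.sqrt_pos.2 (by positivity)

lemma rr_sq (p : ℝ × ℝ) : rr p ^ 2 = p.1 ^ 2 + p.2 ^ 2 :=
  Real.sq_sqrt (by positivity)

lemma Hfun_pos {α : ℝ} (hα : 0 ≤ α) {p : ℝ × ℝ} (hp : p ∈ Hplane) : 0 < Hfun α p := by
  have := rr_pos hp
  unfold Hfun
  positivity

lemma hasDerivAt_rr_fst {p : ℝ × ℝ} (hp : p ∈ Hplane) :
    HasDerivAt (fun t => rr (t, p.2)) (p.1 / rr p) p.1 := by
  have h0 : p.1 ^ 2 + p.2 ^ 2 ≠ 0 := by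
    rw [← rr_sq]
    exact (pow_pos (rr_pos hp) 2).ne'
  refine ((((hasDerivAt_id p.1).pow 2).add_const (p.2 ^ 2)).sqrt h0).congr_deriv ?_
  change (2 * p.1 ^ 1 * 1) / (2 * rr p) = p.1 / rr p
  ring

lemma hasDerivAt_rr_snd {p : ℝ × ℝ} (hp : p ∈ Hplane) :
    HasDerivAt (fun t => rr (p.1, t)) (p.2 / rr p) p.2 := by
  have h0 : p.1 ^ 2 + p.2 ^ 2 ≠ 0 := by
    rw [← rr_sq]
    exact (pow_pos (rr_pos hp) 2).ne'
  refine ((((hasDerivAt_id p.2).pow 2).const_add (p.1 ^ 2)).sqrt h0).congr_deriv ?_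
  change (2 * p.2 ^ 1 * 1) / (2 * rr p) = p.2 / rr p
  ring

lemma hasDerivAt_Hfun_fst (α : ℝ) {p : ℝ × ℝ} (hp : p ∈ Hplane) :
    HasDerivAt (fun t => Hfun α (t, p.2)) (-(α * p.1) / (2 * rr p ^ 3)) p.1 := by
  have hr := (rr_pos hp).ne'
  refine (((hasDerivAt_const p.1 α).div ((hasDerivAt_rr_fst hp).const_mul 2)
    (mul_ne_zero two_ne_zero hr)).const_add 1).congr_deriv ?_
  change (0 * (2 * rr p) - α * (2 * (p.1 / rr p))) / (2 * rr p) ^ 2 = _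
  field_simp
  ring

lemma hasDerivAt_Afun_fst (α : ℝ) {p : ℝ × ℝ} (hp : p ∈ Hplane) :
    HasDerivAt (fun t => Afun α (t, p.2)) (-(α * p.1 * p.2) / (2 * rr p ^ 3)) p.1 := by
  have hr := (rr_pos hp).ne'
  refine ((hasDerivAt_const p.1 (α * p.2)).div ((hasDerivAt_rr_fst hp).const_mul 2)
    (mul_ne_zero two_ne_zero hr)).congr_deriv ?_
  change (0 * (2 * rr p) - α * p.2 * (2 * (p.1 / rr p))) / (2 * rr p) ^ 2 = _
  field_simp
  ring

lemma hasDerivAt_Hfun_snd (α : ℝ) {p : ℝ × ℝ} (hp : p ∈ Hplane) :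
    HasDerivAt (fun t => Hfun α (p.1, t)) (-(α * p.2) / (2 * rr p ^ 3)) p.2 := by
  have hr := (rr_pos hp).ne'
  refine (((hasDerivAt_const p.2 α).div ((hasDerivAt_rr_snd hp).const_mul 2)
    (mul_ne_zero two_ne_zero hr)).const_add 1).congr_deriv ?_
  change (0 * (2 * rr p) - α * (2 * (p.2 / rr p))) / (2 * rr p) ^ 2 = _
  field_simp
  ring

lemma hasDerivAt_Afun_snd (α : ℝ) {p : ℝ × ℝ} (hp : p ∈ Hplane) :
    HasDerivAt (fun t => Afun α (p.1, t)) (α * p.1 ^ 2 / (2 * rr p ^ 3)) p.2 := by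
  have hr := (rr_pos hp).ne'
  refine (((hasDerivAt_id p.2).const_mul α).div ((hasDerivAt_rr_snd hp).const_mul 2)
    (mul_ne_zero two_ne_zero hr)).congr_deriv ?_
  change (α * 1 * (2 * rr p) - α * p.2 * (2 * (p.2 / rr p))) / (2 * rr p) ^ 2 = _
  field_simp
  linear_combination α * rr_sq p

/-- Closed form of `ρ Φ⁻¹ ∂_ρΦ` for the anti-Taub-NUT model. -/
def TNmFormFst (α : ℝ) (p : ℝ × ℝ) : Mat2 :=
  gibbonsHawkingForm (1 - α * p.1 ^ 2 / (rr p ^ 2 * (2 * rr p + α)))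
    (-(2 * α * p.2) / (rr p * (2 * rr p + α) ^ 2))
    (-(α * p.1 ^ 2 * p.2) / (2 * rr p ^ 3)) (Afun α p)

/-- Closed form of `ρ Φ⁻¹ ∂_zΦ` for the anti-Taub-NUT model. -/
def TNmFormSnd (α : ℝ) (p : ℝ × ℝ) : Mat2 :=
  gibbonsHawkingForm (-(α * p.1 * p.2) / (rr p ^ 2 * (2 * rr p + α)))
    (2 * α * p.1 / (rr p * (2 * rr p + α) ^ 2))
    (α * p.1 ^ 3 / (2 * rr p ^ 3)) (Afun α p)

lemma Hfun_eq (α : ℝ) {p : ℝ × ℝ} (hp : p ∈ Hplane) :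
    Hfun α p = (2 * rr p + α) / (2 * rr p) := by
  have hr := (rr_pos hp).ne'
  unfold Hfun
  field_simp

lemma smul_inv_mul_mpd1_ΦTNm {α : ℝ} (hα : 0 ≤ α) {p : ℝ × ℝ} (hp : p ∈ Hplane) :
    p.1 • ((ΦTNm α p)⁻¹ * mpd1 (ΦTNm α) p) = TNmFormFst α p := by
  have hρ : 0 < p.1 := hp
  have hr := rr_pos hp
  have hra : 0 < 2 * rr p + α := by positivity
  refine (smul_inv_mul_deriv_gibbonsHawkingMat (hasDerivAt_id p.1) (hasDerivAt_Hfun_fst α hp)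
    (hasDerivAt_Afun_fst α hp) hρ.ne' (Hfun_pos hα hp).ne').trans ?_
  simp only [id, TNmFormFst, Prod.mk.eta, Hfun_eq α hp]
  congr 1 <;> field_simp
  ring

lemma smul_inv_mul_mpd2_ΦTNm {α : ℝ} (hα : 0 ≤ α) {p : ℝ × ℝ} (hp : p ∈ Hplane) :
    p.1 • ((ΦTNm α p)⁻¹ * mpd2 (ΦTNm α) p) = TNmFormSnd α p := by
  have hρ : 0 < p.1 := hp
  have hr := rr_pos hp
  have hra : 0 < 2 * rr p + α := by positivity
  refine (smul_inv_mul_deriv_gibbonsHawkingMat (hasDerivAt_const p.2 p.1)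
    (hasDerivAt_Hfun_snd α hp) (hasDerivAt_Afun_snd α hp) hρ.ne' (Hfun_pos hα hp).ne').trans ?_
  simp only [TNmFormSnd, Prod.mk.eta, Hfun_eq α hp]
  congr 1 <;> field_simp
  ring

lemma mpd1_congr {F G : ℝ × ℝ → Mat2} (h : ∀ p ∈ Hplane, F p = G p) {p : ℝ × ℝ}
    (hp : p ∈ Hplane) : mpd1 F p = mpd1 G p := by
  ext i j
  refine Filter.EventuallyEq.deriv_eq ?_
  filter_upwards [lt_mem_nhds (show 0 < p.1 from hp)] with t ht
  rw [h (t, p.2) ht]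

lemma mpd2_congr {F G : ℝ × ℝ → Mat2} (h : ∀ p ∈ Hplane, F p = G p) {p : ℝ × ℝ}
    (hp : p ∈ Hplane) : mpd2 F p = mpd2 G p := by
  ext i j
  refine Filter.EventuallyEq.deriv_eq (Filter.Eventually.of_forall fun t => ?_)
  simp only [h (p.1, t) hp]

lemma deriv_gibbonsHawkingForm {q w g A : ℝ → ℝ} {q' w' g' A' t : ℝ}
    (dq : HasDerivAt q q' t) (dw : HasDerivAt w w' t) (dg : HasDerivAt g g' t)
    (dA : HasDerivAt A A' t) :
    (Matrix.of fun i j => deriv (fun s => gibbonsHawkingForm (q s) (w s) (g s) (A s) i j) t) =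
      !![q' + (A' * w t + A t * w'), w';
         g' - 2 * (A' * q t + A t * q') - (2 * A t * A' * w t + A t ^ 2 * w'),
         -(q' + (A' * w t + A t * w'))] := by
  have d00 := dq.add (dA.mul dw)
  have d10 := (dg.sub ((dA.const_mul 2).mul dq)).sub ((dA.pow 2).mul dw)
  ext i j
  fin_cases i <;> fin_cases j
  · exact d00.deriv
  · exact dw.deriv
  · refine d10.deriv.trans ?_
    simp
    ring
  · exact d00.neg.deriv

lemma mpd1_TNmFormFst_add_mpd2_TNmFormSnd {α : ℝ} (hα : 0 ≤ α) {p : ℝ × ℝ}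
    (hp : p ∈ Hplane) : mpd1 (TNmFormFst α) p + mpd2 (TNmFormSnd α) p = 0 := by
  have hr := rr_pos hp
  have hra : 0 < 2 * rr p + α := by positivity
  have i1 := hasDerivAt_id p.1
  have i2 := hasDerivAt_id p.2
  have r1 := hasDerivAt_rr_fst hp
  have r2 := hasDerivAt_rr_snd hp
  have a1 := (r1.const_mul 2).add_const α
  have a2 := (r2.const_mul 2).add_const α
  have h3 : 2 * rr p ^ 3 ≠ 0 := by positivity
  have hq : rr p ^ 2 * (2 * rr p + α) ≠ 0 := by positivity
  have hw : rr p * (2 * rr p + α) ^ 2 ≠ 0 := by positivity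
  have dq1 := (((i1.pow 2).const_mul α).div ((r1.pow 2).mul a1) hq).const_sub 1
  have dw1 := (hasDerivAt_const p.1 (-(2 * α * p.2))).div (r1.mul (a1.pow 2)) hw
  have dg1 := (((i1.pow 2).const_mul α).mul_const p.2).neg.div ((r1.pow 3).const_mul 2) h3
  have dq2 := (i2.const_mul (α * p.1)).neg.div ((r2.pow 2).mul a2) hq
  have dw2 := (hasDerivAt_const p.2 (2 * α * p.1)).div (r2.mul (a2.pow 2)) hw
  have dg2 := (hasDerivAt_const p.2 (α * p.1 ^ 3)).div ((r2.pow 3).const_mul 2) h3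
  have e1 := deriv_gibbonsHawkingForm dq1 dw1 dg1 (hasDerivAt_Afun_fst α hp)
  have e2 := deriv_gibbonsHawkingForm dq2 dw2 dg2 (hasDerivAt_Afun_snd α hp)
  have hz : p.1 ^ 2 = rr p ^ 2 - p.2 ^ 2 := by rw [rr_sq]; ring
  refine (congrArg₂ (· + ·) e1 e2).trans ?_
  ext i j
  fin_cases i <;> fin_cases j <;> simp [Afun] <;> field_simp
  · linear_combination 3 * α * p.1 * (2 * rr p + α) ^ 2 * hz
  · ring
  · linear_combination -6 * α ^ 2 * p.1 * p.2 * (2 * rr p + α) ^ 2 * hz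
  · linear_combination -3 * α * p.1 * (2 * rr p + α) ^ 2 * hz

lemma trace_gibbonsHawkingForm_mul (q w g q' w' g' A : ℝ) :
    (gibbonsHawkingForm q w g A * gibbonsHawkingForm q' w' g' A).trace =
      2 * q * q' + w * g' + w' * g := by
  simp [gibbonsHawkingForm, Matrix.trace, Fin.sum_univ_two]
  ring

lemma trace_gibbonsHawkingForm (q w g A : ℝ) : (gibbonsHawkingForm q w g A).trace = 0 := by
  simp [gibbonsHawkingForm, Matrix.trace, Fin.sum_univ_two]

lemma contDiffOn_νTNm {α : ℝ} (hα : 0 ≤ α) :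
    ContDiffOn ℝ (⊤ : ℕ∞) (νTNm α) Hplane := by
  have hr : ContDiffOn ℝ (⊤ : ℕ∞) rr Hplane := by
    refine ContDiffOn.sqrt (by fun_prop) fun p hp => ?_
    rw [← rr_sq]
    exact (pow_pos (rr_pos hp) 2).ne'
  refine contDiffOn_const.mul (ContDiffOn.log (contDiffOn_const.add (contDiffOn_const.div
    (contDiffOn_const.mul hr) fun p hp => ?_)) fun p hp => (Hfun_pos hα hp).ne')
  exact mul_ne_zero two_ne_zero (rr_pos hp).ne'

lemma isAugmentationOn_νTNm {α : ℝ} (hα : 0 ≤ α) :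
    IsAugmentationOn (ΦTNm α) (νTNm α) Hplane := by
  refine ⟨contDiffOn_νTNm hα, fun p hp => ?_⟩
  have hρ : 0 < p.1 := hp
  have hr := rr_pos hp
  have hra : 0 < 2 * rr p + α := by positivity
  have hH := (Hfun_pos hα hp).ne'
  have d1 : pd1 (νTNm α) p = _ := (((hasDerivAt_Hfun_fst α hp).log hH).const_mul (1 / 2)).deriv
  have d2 : pd2 (νTNm α) p = _ := (((hasDerivAt_Hfun_snd α hp).log hH).const_mul (1 / 2)).deriv
  rw [d1, d2, Umat, Vmat, smul_inv_mul_mpd1_ΦTNm hα hp, smul_inv_mul_mpd2_ΦTNm hα hp]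
  simp only [add_mul, mul_add, one_mul, mul_one, Matrix.trace_add, Matrix.trace_sub,
    Matrix.trace_one, TNmFormFst, TNmFormSnd, trace_gibbonsHawkingForm,
    trace_gibbonsHawkingForm_mul, Prod.mk.eta, Hfun_eq α hp, Fintype.card_fin]
  constructor
  · field_simp
    ring
  · field_simp
    ring

/-- For every `α ≥ 0`, the anti–Taub-NUT model `Φ^{TN⁻_α}` is symmetric
positive definite of determinant `1` on `ℍ°`, satisfies the axisymmetric harmonic-map
equation there, and `ν^{TN⁻_α} = ½ log(1 + α/(2r))` is an augmentation for it.
For `α = 0` one gets the flat model `Φ^{AF₀} = diag(ρ, ρ⁻¹)` with augmentation `0`. -/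
theorem stmt6 (α : ℝ) (hα : 0 ≤ α) :
    (∀ p ∈ Hplane, (ΦTNm α p).PosDef ∧ (ΦTNm α p).det = 1) ∧
    axiHarmonicOn (ΦTNm α) Hplane ∧
    IsAugmentationOn (ΦTNm α) (νTNm α) Hplane ∧
    (∀ p ∈ Hplane, ΦTNm 0 p = !![p.1, 0; 0, p.1⁻¹]) ∧
    (∀ p ∈ Hplane, νTNm 0 p = 0) := by
  refine ⟨fun p hp => ⟨gibbonsHawkingMat_posDef _ hp (Hfun_pos hα hp),
    gibbonsHawkingMat_det _ (ne_of_gt hp) (Hfun_pos hα hp).ne'⟩, fun p hp => ?_,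
    isAugmentationOn_νTNm hα, fun p hp => ?_, fun p _ => by simp [νTNm]⟩
  · rw [mpd1_congr (fun q => smul_inv_mul_mpd1_ΦTNm hα) hp,
      mpd2_congr (fun q => smul_inv_mul_mpd2_ΦTNm hα) hp]
    exact mpd1_TNmFormFst_add_mpd2_TNmFormSnd hα hp
  · have hρ : p.1 ≠ 0 := ne_of_gt hp
    ext i j
    fin_cases i <;> fin_cases j <;> simp [ΦTNm, Hfun, Afun]
    field_simp
end
end
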